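/- The minimum-error (global) guessing probability of a tensor product of ensembles factorizes exactly: p_G(⊗_{l=1}^L E^l) = Π_{l=1}^L p_G(E^l). -/

import Mathlib

open Matrix BigOperators ComplexOrder

noncomputable section

/-- Tensor product of a family of local operators, one per party/step. -/
def tensorFam {m : ℕ} {ι : Fin m → Type*} [∀ k, Fintype (ι k)]
    (A : (k : Fin m) → Matrix (ι k) (ι k) ℂ) :
    Matrix ((k : Fin m) → ι k) ((k : Fin m) → ι k) ℂ :=
  Matrix.of fun i j => ∏ k, A k (i k) (j k)

/-- Separable operator: a sum of tensor products of positive semidefinite local operators. -/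
def IsSep {m : ℕ} {ι : Fin m → Type*} [∀ k, Fintype (ι k)]
    (E : Matrix ((k : Fin m) → ι k) ((k : Fin m) → ι k) ℂ) : Prop :=
  ∃ (S : Finset ℕ) (A : ℕ → (k : Fin m) → Matrix (ι k) (ι k) ℂ),
    (∀ s ∈ S, ∀ k, (A s k).PosSemidef) ∧ E = ∑ s ∈ S, tensorFam (A s)

/-- Separable state: separable with trace one. -/
def IsSepState {m : ℕ} {ι : Fin m → Type*} [∀ k, Fintype (ι k)]
    (σ : Matrix ((k : Fin m) → ι k) ((k : Fin m) → ι k) ℂ) : Prop :=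
  IsSep σ ∧ σ.trace = 1

/-- Block positive: nonnegative mean value on every separable state. -/
def IsBlockPos {m : ℕ} {ι : Fin m → Type*} [∀ k, Fintype (ι k)]
    (E : Matrix ((k : Fin m) → ι k) ((k : Fin m) → ι k) ℂ) : Prop :=
  ∀ σ, IsSepState σ → 0 ≤ ((E * σ).trace).re

def IsPOVM {α N : Type*} [Fintype α] [Fintype N] [DecidableEq N]
    (M : α → Matrix N N ℂ) : Prop :=
  (∀ i, (M i).PosSemidef) ∧ ∑ i, M i = 1

/-- Average success probability of a guessing strategy. -/
def succProb {α N : Type*} [Fintype α] [Fintype N]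
    (η : α → ℝ) (ρ M : α → Matrix N N ℂ) : ℝ :=
  ∑ i, η i * ((ρ i * M i).trace).re

namespace Matrix

open scoped Matrix.Norms.L2Operator MatrixOrder in
theorem PosSemidef.exists_eq_conjTranspose_mul_self {N : Type*} [Fintype N] {A : Matrix N N ℂ}
    (hA : A.PosSemidef) : ∃ B : Matrix N N ℂ, A = Bᴴ * B := by
  classical
  exact CStarAlgebra.nonneg_iff_eq_star_mul_self.mp hA.nonneg

theorem PosSemidef.re_trace_mul_nonneg {N : Type*} [Fintype N] {A B : Matrix N N ℂ}
    (hA : A.PosSemidef) (hB : B.PosSemidef) : 0 ≤ ((A * B).trace).re := by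
  obtain ⟨C, rfl⟩ := hA.exists_eq_conjTranspose_mul_self
  rw [Matrix.mul_assoc, trace_mul_comm]
  exact (Complex.le_def.mp (hB.mul_mul_conjTranspose_same C).trace_nonneg).1

open scoped Matrix.Norms.L2Operator MatrixOrder in
theorem IsHermitian.exists_add_smul_one_posSemidef {N : Type*} [Fintype N] [DecidableEq N]
    {Y : Matrix N N ℂ} (hY : Y.IsHermitian) :
    ∃ a : ℝ, (Y + a • (1 : Matrix N N ℂ)).PosSemidef := by
  have h := IsSelfAdjoint.neg_algebraMap_norm_le_self (a := Y) hY
  refine ⟨‖Y‖, ?_⟩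
  rw [Matrix.le_iff] at h
  simpa [Algebra.algebraMap_eq_smul_one] using h

theorem exists_trace_mul_eq {N : Type*} [Fintype N] [DecidableEq N]
    (φ : Matrix N N ℂ →ₗ[ℂ] ℂ) : ∃ H : Matrix N N ℂ, ∀ X, (H * X).trace = φ X := by
  refine ⟨Matrix.of fun i j => φ (single j i 1), fun X => ?_⟩
  conv_rhs => rw [matrix_eq_sum_single X]
  simp only [map_sum, trace, diag, mul_apply, of_apply]
  rw [Finset.sum_comm]
  refine Finset.sum_congr rfl fun i _ => Finset.sum_congr rfl fun j _ => ?_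
  rw [← mul_one (X i j), ← smul_eq_mul (X i j) 1, ← smul_single (X i j) i j (1 : ℂ), map_smul,
    smul_eq_mul, smul_eq_mul, mul_one, mul_comm]

/-- Every real functional on matrices is represented on the Hermitian ones by a Hermitian matrix. -/
theorem exists_isHermitian_re_trace_mul_eq {N : Type*} [Fintype N] [DecidableEq N]
    (φ : Matrix N N ℂ →ₗ[ℝ] ℝ) :
    ∃ H : Matrix N N ℂ, H.IsHermitian ∧
      ∀ X : Matrix N N ℂ, X.IsHermitian → ((H * X).trace).re = φ X := by
  obtain ⟨H, hH⟩ := exists_trace_mul_eq (Module.Dual.extendRCLike (𝕜 := ℂ) φ)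
  have hre (X : Matrix N N ℂ) : ((H * X).trace).re = φ X := by
    rw [hH]; exact Module.Dual.re_extendRCLike_apply (𝕜 := ℂ) φ X
  refine ⟨(1 / 2 : ℝ) • (H + Hᴴ), ?_, fun X hX => ?_⟩
  · simp [IsHermitian, conjTranspose_smul, add_comm]
  · have h : ((Hᴴ * X).trace).re = ((H * X).trace).re := by
      rw [← hX.eq, ← conjTranspose_mul, trace_conjTranspose, trace_mul_comm, hX.eq]
      simp
    rw [smul_mul_assoc, trace_smul, add_mul, trace_add, Complex.smul_re, Complex.add_re, h,
      hre, smul_eq_mul]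
    ring

theorem PosSemidef.of_re_trace_mul_nonneg {N : Type*} [Fintype N] {A : Matrix N N ℂ}
    (hA : A.IsHermitian)
    (h : ∀ X : Matrix N N ℂ, X.PosSemidef → 0 ≤ ((A * X).trace).re) : A.PosSemidef := by
  refine .of_dotProduct_mulVec_nonneg hA fun v => ?_
  rw [Complex.le_def]
  refine ⟨?_, (hA.im_star_dotProduct_mulVec_self v).symm⟩
  have := h _ (posSemidef_vecMulVec_self_star v)
  rwa [mul_vecMulVec, trace_vecMulVec, dotProduct_comm] at this

end Matrix

/-- The pairs `(X, t)` such that the Hermitian part of `X` splits into positive semidefinite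
operators `M i` with `t ≤ ∑ i, Tr (W i * M i)`. -/
def guessingCone {α N : Type*} [Fintype α] [Fintype N] (W : α → Matrix N N ℂ) :
    PointedCone ℝ (Matrix N N ℂ × ℝ) where
  carrier := {x | ∃ M : α → Matrix N N ℂ, (∀ i, (M i).PosSemidef) ∧
    x.1 + x.1ᴴ = (2 : ℝ) • ∑ i, M i ∧ x.2 ≤ ∑ i, ((W i * M i).trace).re}
  zero_mem' := ⟨fun _ => 0, fun _ => .zero, by simp, by simp⟩
  add_mem' := by
    rintro ⟨X, s⟩ ⟨Y, t⟩ ⟨M, hM, hX, hs⟩ ⟨K, hK, hY, ht⟩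
    refine ⟨fun i => M i + K i, fun i => (hM i).add (hK i), ?_, ?_⟩
    · dsimp only at hX hY
      simp only [Prod.fst_add, conjTranspose_add, Finset.sum_add_distrib, smul_add, ← hX, ← hY]
      abel
    · dsimp only at hs ht
      simpa [mul_add, Finset.sum_add_distrib] using add_le_add hs ht
  smul_mem' := by
    rintro ⟨c, hc⟩ ⟨X, s⟩ ⟨M, hM, hX, hs⟩
    refine ⟨fun i => c • M i, fun i => (hM i).smul hc, ?_, ?_⟩
    · dsimp only at hX
      change c • X + (c • X)ᴴ = _
      rw [← Finset.smul_sum, smul_comm, ← hX, conjTranspose_smul, smul_add]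
      simp
    · change c * s ≤ _
      simpa [Finset.mul_sum] using mul_le_mul_of_nonneg_left hs hc

theorem mem_guessingCone_of_posSemidef {α N : Type*} [Fintype α] [Fintype N]
    {W : α → Matrix N N ℂ} (i : α) {P : Matrix N N ℂ} (hP : P.PosSemidef)
    {x : Matrix N N ℂ × ℝ} (hx : x.1 + x.1ᴴ = (2 : ℝ) • P) (ht : x.2 ≤ ((W i * P).trace).re) :
    x ∈ guessingCone W := by
  classical
  refine ⟨fun j => if j = i then P else 0, fun j => ?_, by simpa using hx, ?_⟩
  · dsimp only
    split_ifs
    exacts [hP, .zero]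
  · simpa [apply_ite] using ht

theorem sum_re_trace_mul_le_of_sum_eq_smul_one {α N : Type*} [Fintype α] [Fintype N]
    [DecidableEq N] [Nonempty N] {W : α → Matrix N N ℂ} {p : ℝ}
    (hp : ∀ M, IsPOVM M → ∑ i, ((W i * M i).trace).re ≤ p)
    {M : α → Matrix N N ℂ} (hM : ∀ i, (M i).PosSemidef) {a : ℝ}
    (hsum : ∑ i, M i = a • (1 : Matrix N N ℂ)) : ∑ i, ((W i * M i).trace).re ≤ a * p := by
  have htr : (∑ i, (M i).trace) = a * (Fintype.card N : ℂ) := by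
    rw [← trace_sum, hsum]; simp
  have hre (i) : 0 ≤ (M i).trace := (hM i).trace_nonneg
  have hcard : (0 : ℝ) < Fintype.card N := by exact_mod_cast Fintype.card_pos
  have ha : 0 ≤ a := by
    have h : 0 ≤ (a * (Fintype.card N : ℂ)) := htr ▸ Finset.sum_nonneg fun i _ => hre i
    have h' : (0 : ℝ) ≤ a * Fintype.card N := by exact_mod_cast h
    exact nonneg_of_mul_nonneg_left h' hcard
  rcases ha.eq_or_lt with rfl | ha
  · have h0 (i) : M i = 0 := by
      rw [← (hM i).trace_eq_zero_iff]
      refine (Finset.sum_eq_zero_iff_of_nonneg fun i _ => hre i).mp ?_ i (Finset.mem_univ i)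
      simpa using htr
    simp [h0]
  · have := hp (fun i => a⁻¹ • M i) ⟨fun i => (hM i).smul (inv_nonneg.mpr ha.le), by
      rw [← Finset.smul_sum, hsum, smul_smul, inv_mul_cancel₀ ha.ne', one_smul]⟩
    simp only [mul_smul_comm, trace_smul, Complex.smul_re, smul_eq_mul, ← Finset.mul_sum] at this
    rwa [inv_mul_le_iff₀ ha] at this

/-- Strong duality for the guessing problem: an upper bound on the value of all measurements is
the trace of a dual feasible operator. -/
theorem exists_dual_feasible {α N : Type*} [Fintype α] [Nonempty α] [Fintype N]
    [DecidableEq N] [Nonempty N] {W : α → Matrix N N ℂ} (hW : ∀ i, (W i).IsHermitian) {p : ℝ}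
    (hp : ∀ M, IsPOVM M → ∑ i, ((W i * M i).trace).re ≤ p) :
    ∃ H : Matrix N N ℂ, (∀ i, (H - W i).PosSemidef) ∧ H.trace = p := by
  have hcard : (Fintype.card N : ℝ) ≠ 0 := by exact_mod_cast Fintype.card_ne_zero
  let f₀ : Matrix N N ℂ × ℝ →ₗ[ℝ] ℝ :=
    ((p / Fintype.card N) • (Complex.reLm ∘ₗ traceLinearMap N ℝ ℂ)) ∘ₗ LinearMap.fst ℝ _ _
      - LinearMap.snd ℝ _ _
  have hf₀ (a t : ℝ) : f₀ (a • 1, t) = a * p - t := by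
    simp [f₀]
    field_simp
  let D : Submodule ℝ (Matrix N N ℂ × ℝ) := (Submodule.span ℝ {1}).prod ⊤
  have hD (a t : ℝ) : ((a • 1, t) : Matrix N N ℂ × ℝ) ∈ D :=
    ⟨Submodule.smul_mem _ a (Submodule.mem_span_singleton_self 1), trivial⟩
  obtain ⟨g, hgf, hg⟩ := riesz_extension (guessingCone W) (f₀.toPMap D) (by
    rintro ⟨⟨X, t⟩, hX, _⟩ ⟨M, hM, hXM, ht⟩
    dsimp only at hX hXM ht
    obtain ⟨a, rfl⟩ := Submodule.mem_span_singleton.mp hX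
    change 0 ≤ f₀ (a • 1, t)
    rw [hf₀, sub_nonneg]
    refine ht.trans (sum_re_trace_mul_le_of_sum_eq_smul_one hp hM ?_)
    rw [← smul_right_injective (Matrix N N ℂ) (two_ne_zero (α := ℝ)) |>.eq_iff, ← hXM]
    simp [conjTranspose_smul, two_smul]) (by
    rintro ⟨Y, t⟩
    obtain ⟨a, ha⟩ := ((isHermitian_add_transpose_self Y).smul
      (IsSelfAdjoint.all (1 / 2 : ℝ))).exists_add_smul_one_posSemidef
    obtain ⟨i₀⟩ := ‹Nonempty α›
    refine ⟨⟨(a • 1, ((W i₀ * ((1 / 2 : ℝ) • (Y + Yᴴ) + a • 1)).trace).re - t), hD _ _⟩,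
      mem_guessingCone_of_posSemidef i₀ ha ?_ (by simp)⟩
    simp only [Prod.fst_add, conjTranspose_add, conjTranspose_smul, conjTranspose_one,
      star_trivial]
    module)
  obtain ⟨H, hH, hHg⟩ := exists_isHermitian_re_trace_mul_eq (g ∘ₗ LinearMap.inl ℝ _ _)
  have hg_one (a t : ℝ) : g (a • 1, t) = a * p - t := (hgf ⟨_, hD a t⟩).trans (hf₀ a t)
  refine ⟨H, fun i => .of_re_trace_mul_nonneg (hH.sub (hW i)) fun X hX => ?_, ?_⟩
  · have h := hg (X, ((W i * X).trace).re)
      (mem_guessingCone_of_posSemidef i hX (by rw [hX.isHermitian.eq, two_smul]) le_rfl)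
    have hsplit : ((X, ((W i * X).trace).re) : Matrix N N ℂ × ℝ) =
        LinearMap.inl ℝ _ _ X + ((0 : ℝ) • 1, ((W i * X).trace).re) := by simp
    rw [hsplit, map_add, hg_one] at h
    have := hHg X hX.isHermitian
    rw [LinearMap.comp_apply] at this
    rw [sub_mul, trace_sub, Complex.sub_re, this]
    linarith
  · have h := hHg 1 isHermitian_one
    have h1 := hg_one 1 0
    rw [LinearMap.comp_apply, LinearMap.inl_apply, mul_one] at h
    rw [one_smul, ← h] at h1
    apply Complex.ext
    · simpa using h1
    · have : star H.trace = H.trace := by rw [← trace_conjTranspose, hH.eq]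
      simpa using Complex.conj_eq_iff_im.mp this

section Tensor

variable {m : ℕ} {ι : Fin m → Type*} [∀ k, Fintype (ι k)]

theorem tensorFam_mul (A B : (k : Fin m) → Matrix (ι k) (ι k) ℂ) :
    tensorFam A * tensorFam B = tensorFam fun k => A k * B k := by
  ext i j
  simp only [tensorFam, mul_apply, of_apply, ← Finset.prod_mul_distrib]
  rw [Finset.prod_univ_sum, Fintype.piFinset_univ]

theorem trace_tensorFam (A : (k : Fin m) → Matrix (ι k) (ι k) ℂ) :
    (tensorFam A).trace = ∏ k, (A k).trace := by
  simp only [tensorFam, trace, diag, of_apply]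
  rw [Finset.prod_univ_sum, Fintype.piFinset_univ]

theorem conjTranspose_tensorFam (A : (k : Fin m) → Matrix (ι k) (ι k) ℂ) :
    (tensorFam A)ᴴ = tensorFam fun k => (A k)ᴴ := by
  ext i j
  simp [tensorFam, conjTranspose_apply]

theorem tensorFam_one [∀ k, DecidableEq (ι k)] :
    tensorFam (fun k => (1 : Matrix (ι k) (ι k) ℂ)) = 1 := by
  ext i j
  simp only [tensorFam, of_apply, one_apply, Finset.prod_ite_zero, funext_iff]
  simp

theorem tensorFam_smul (c : Fin m → ℝ) (A : (k : Fin m) → Matrix (ι k) (ι k) ℂ) :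
    tensorFam (fun k => c k • A k) = (∏ k, c k) • tensorFam A := by
  ext i j
  simp [tensorFam, Finset.prod_mul_distrib]

theorem sum_tensorFam {α : Fin m → Type*} [∀ k, Fintype (α k)]
    (A : (k : Fin m) → α k → Matrix (ι k) (ι k) ℂ) :
    ∑ c : (k : Fin m) → α k, tensorFam (fun k => A k (c k)) =
      tensorFam fun k => ∑ i, A k i := by
  ext i j
  simp only [tensorFam, Matrix.sum_apply, of_apply]
  rw [Finset.prod_univ_sum, Fintype.piFinset_univ]

theorem tensorFam_posSemidef {A : (k : Fin m) → Matrix (ι k) (ι k) ℂ}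
    (hA : ∀ k, (A k).PosSemidef) : (tensorFam A).PosSemidef := by
  choose B hB using fun k => (hA k).exists_eq_conjTranspose_mul_self
  rw [funext hB, ← tensorFam_mul, ← conjTranspose_tensorFam]
  exact posSemidef_conjTranspose_mul_self _

theorem tensorFam_add (A B : (k : Fin m) → Matrix (ι k) (ι k) ℂ) :
    tensorFam (fun k => A k + B k) =
      ∑ t : Finset (Fin m), tensorFam fun k => if k ∈ t then A k else B k := by
  ext i j
  simp only [tensorFam, Matrix.sum_apply, of_apply, Matrix.add_apply, Fintype.prod_add]
  refine Finset.sum_congr rfl fun t _ => ?_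
  rw [← Finset.prod_mul_prod_compl t fun k => (if k ∈ t then A k else B k) (i k) (j k)]
  congr 1 <;> refine Finset.prod_congr rfl fun k hk => ?_ <;> simp_all

theorem tensorFam_sub_posSemidef {A H : (k : Fin m) → Matrix (ι k) (ι k) ℂ}
    (hA : ∀ k, (A k).PosSemidef) (hH : ∀ k, (H k - A k).PosSemidef) :
    (tensorFam H - tensorFam A).PosSemidef := by
  have h : tensorFam H =
      ∑ t : Finset (Fin m), tensorFam fun k => if k ∈ t then A k else H k - A k := by
    rw [← tensorFam_add]; simp
  rw [h, ← Finset.sum_erase_add _ _ (Finset.mem_univ Finset.univ)]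
  simp only [Finset.mem_univ, if_true, add_sub_cancel_right]
  refine posSemidef_sum _ fun t _ => tensorFam_posSemidef fun k => ?_
  split_ifs
  exacts [hA k, hH k]

theorem re_trace_tensorFam {A : (k : Fin m) → Matrix (ι k) (ι k) ℂ}
    (hA : ∀ k, (A k).trace.im = 0) : (tensorFam A).trace.re = ∏ k, (A k).trace.re := by
  have h (k) : (A k).trace = ((A k).trace.re : ℂ) := Complex.ext rfl (by simp [hA])
  rw [trace_tensorFam, Finset.prod_congr rfl fun k _ => h k, ← Complex.ofReal_prod,
    Complex.ofReal_re]

theorem IsPOVM.tensorFam [∀ k, DecidableEq (ι k)] {α : Fin m → Type*} [∀ k, Fintype (α k)]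
    {M : (k : Fin m) → α k → Matrix (ι k) (ι k) ℂ} (hM : ∀ k, IsPOVM (M k)) :
    IsPOVM fun c : (k : Fin m) → α k => _root_.tensorFam fun k => M k (c k) :=
  ⟨fun c => tensorFam_posSemidef fun k => (hM k).1 (c k), by
    rw [sum_tensorFam, funext fun k => (hM k).2, tensorFam_one]⟩

end Tensor

theorem succProb_eq_sum_re_trace {α N : Type*} [Fintype α] [Fintype N]
    (η : α → ℝ) (ρ M : α → Matrix N N ℂ) :
    succProb η ρ M = ∑ i, (((η i • ρ i) * M i).trace).re := by
  simp [succProb]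

theorem im_trace_mul_eq_zero {N : Type*} [Fintype N] {A B : Matrix N N ℂ}
    (hA : A.IsHermitian) (hB : B.IsHermitian) : ((A * B).trace).im = 0 := by
  have h : star ((A * B).trace) = (A * B).trace := by
    rw [← trace_conjTranspose, conjTranspose_mul, hA.eq, hB.eq, trace_mul_comm]
  exact Complex.conj_eq_iff_im.mp h

theorem succProb_tensorFam {m : ℕ} {ι α : Fin m → Type*} [∀ k, Fintype (ι k)]
    [∀ k, Fintype (α k)] (η : (k : Fin m) → α k → ℝ)
    {ρ M : (k : Fin m) → α k → Matrix (ι k) (ι k) ℂ}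
    (hρ : ∀ k i, (ρ k i).IsHermitian) (hM : ∀ k i, (M k i).IsHermitian) :
    succProb (fun c : (k : Fin m) → α k => ∏ k, η k (c k))
      (fun c => tensorFam fun k => ρ k (c k)) (fun c => tensorFam fun k => M k (c k)) =
      ∏ k, succProb (η k) (ρ k) (M k) := by
  simp only [succProb, tensorFam_mul]
  rw [Finset.prod_univ_sum, Fintype.piFinset_univ]
  refine Finset.sum_congr rfl fun c _ => ?_
  rw [re_trace_tensorFam fun k => im_trace_mul_eq_zero (hρ k _) (hM k _),
    Finset.prod_mul_distrib]

theorem succProb_le_trace_of_dual_feasible {α N : Type*} [Fintype α] [Fintype N] [DecidableEq N]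
    {η : α → ℝ} {ρ M : α → Matrix N N ℂ} (hM : IsPOVM M) {H : Matrix N N ℂ}
    (hH : ∀ i, (H - η i • ρ i).PosSemidef) : succProb η ρ M ≤ H.trace.re := by
  have h : H.trace.re = ∑ i, ((H * M i).trace).re := by
    rw [← Complex.re_sum, ← trace_sum, ← Finset.mul_sum, hM.2, mul_one]
  rw [h, succProb_eq_sum_re_trace]
  refine Finset.sum_le_sum fun i _ => ?_
  have := (hH i).re_trace_mul_nonneg (hM.1 i)
  rwa [sub_mul, trace_sub, Complex.sub_re, sub_nonneg] at this

/-- the minimum-error (global) guessing probability of a tensor product of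
ensembles factorizes exactly into the product of the per-ensemble guessing
probabilities. -/
theorem global_guessing_factorizes {L : ℕ} {κ : Fin L → Type*}
    [∀ l, Fintype (κ l)] [∀ l, DecidableEq (κ l)]
    {n : Fin L → ℕ}
    (η : (l : Fin L) → Fin (n l) → ℝ)
    (ρ : (l : Fin L) → Fin (n l) → Matrix (κ l) (κ l) ℂ)
    (hη : ∀ l i, 0 < η l i) (hsum : ∀ l, ∑ i, η l i = 1)
    (hρ : ∀ l i, (ρ l i).PosSemidef ∧ (ρ l i).trace = 1)
    (pG : Fin L → ℝ)
    (hpG : ∀ l, IsLUB ((fun M => succProb (η l) (ρ l) M) '' {M | IsPOVM M}) (pG l))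
    (PG : ℝ)
    (hPG : IsLUB ((fun M => succProb (fun c : (l : Fin L) → Fin (n l) => ∏ l, η l (c l))
      (fun c => tensorFam (fun l => ρ l (c l))) M) '' {M | IsPOVM M}) PG) :
    PG = ∏ l, pG l := by
  apply le_antisymm
  · have hdual (l) : ∃ H : Matrix (κ l) (κ l) ℂ,
        (∀ i, (H - η l i • ρ l i).PosSemidef) ∧ H.trace = pG l := by
      have : Nonempty (Fin (n l)) := by
        by_contra h
        rw [not_nonempty_iff] at h
        simpa using hsum l
      have : Nonempty (κ l) := by
        by_contra h
        rw [not_nonempty_iff] at h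
        obtain ⟨i⟩ := ‹Nonempty (Fin (n l))›
        simpa [trace] using (hρ l i).2
      refine exists_dual_feasible (fun i => ((hρ l i).1.smul (hη l i).le).isHermitian)
        fun M hM => ?_
      rw [← succProb_eq_sum_re_trace]
      exact (hpG l).1 ⟨M, hM, rfl⟩
    choose H hH htr using hdual
    refine hPG.2 ?_
    rintro _ ⟨M, hM, rfl⟩
    refine (succProb_le_trace_of_dual_feasible (H := tensorFam H) hM fun c => ?_).trans_eq ?_
    · rw [← tensorFam_smul]
      exact tensorFam_sub_posSemidef (fun l => (hρ l _).1.smul (hη l _).le) fun l => hH l _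
    · rw [re_trace_tensorFam fun l => by simp [htr]]
      simp [htr]
  · have hmem : pG ∈ closure (Set.univ.pi fun l =>
        (fun M => succProb (η l) (ρ l) M) '' {M | IsPOVM M}) := by
      rw [closure_pi_set]
      exact fun l _ => (hpG l).mem_closure (hpG l).nonempty
    have hcont : Continuous fun x : Fin L → ℝ => ∏ l, x l := by fun_prop
    refine isClosed_Iic.closure_subset (map_mem_closure (t := Set.Iic PG) hcont hmem ?_)
    intro x hx
    choose M hM hMx using fun l => hx l trivial
    refine (hPG.1 ⟨_, IsPOVM.tensorFam hM, rfl⟩).trans_eq' ?_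
    simp only [← hMx]
    exact succProb_tensorFam η (fun l i => (hρ l i).1.isHermitian)
      fun l i => ((hM l).1 i).isHermitian
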